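/- D ∈ A if and only if f(Z(J)) ∩ f(ℂⁿ ∖ Z(J)) = ∅, i.e., no value of f is attained both at a point of the ramification locus and at a point outside it. -/

import Mathlib

noncomputable section

open MvPolynomial

/-- The multiplicity of `Q` in the factorization of `P` equals `e`. -/
def MultIs {σ : Type} (Q P : MvPolynomial σ ℂ) (e : ℕ) : Prop :=
  Q ^ e ∣ P ∧ ¬ Q ^ (e + 1) ∣ P

/-- The Jacobian `det (∂ f i / ∂ X j)` of an `n`-tuple of polynomials. -/
def Jac {n : ℕ} (f : Fin n → MvPolynomial (Fin n) ℂ) : MvPolynomial (Fin n) ℂ :=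
  (Matrix.of fun i j : Fin n => pderiv j (f i)).det

/-- `RamIdx A Q e` : the contraction `QB ∩ A` is generated by an irreducible `P ∈ A`,
and `e` is the multiplicity of `Q` in the factorization of `P` in `B`. -/
def RamIdx {σ : Type} (A : Subalgebra ℂ (MvPolynomial σ ℂ))
    (Q : MvPolynomial σ ℂ) (e : ℕ) : Prop :=
  ∃ P : A, Irreducible P ∧
    (Ideal.span {Q}).comap (algebraMap A (MvPolynomial σ ℂ)) = Ideal.span {P} ∧
    MultIs Q (P : MvPolynomial σ ℂ) e

/-- `Q` is a ramified irreducible of `B` over `A`. -/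
def IsRamified {σ : Type} (A : Subalgebra ℂ (MvPolynomial σ ℂ))
    (Q : MvPolynomial σ ℂ) : Prop :=
  Irreducible Q ∧ ∃ e, RamIdx A Q e ∧ 1 < e

/-- `RamReps A S e` : `S` is a finite set of pairwise non-associated irreducible elements of `B`,
each ramified with ramification index `e Q`, and every ramified irreducible of `B` is associated
to exactly one element of `S`. -/
def RamReps {σ : Type} (A : Subalgebra ℂ (MvPolynomial σ ℂ))
    (S : Finset (MvPolynomial σ ℂ)) (e : MvPolynomial σ ℂ → ℕ) : Prop :=
  (∀ Q ∈ S, Irreducible Q ∧ RamIdx A Q (e Q) ∧ 1 < e Q) ∧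
  (∀ Q ∈ S, ∀ Q' ∈ S, Q ≠ Q' → ¬ Associated Q Q') ∧
  (∀ Q : MvPolynomial σ ℂ, IsRamified A Q → ∃! Q', Q' ∈ S ∧ Associated Q Q')

/-- The polynomial map `ℂⁿ → ℂⁿ` associated to an `n`-tuple of polynomials. -/
def polyMap {n : ℕ} (f : Fin n → MvPolynomial (Fin n) ℂ) : (Fin n → ℂ) → (Fin n → ℂ) :=
  fun x i => eval x (f i)

/-- The branch locus: points whose fiber has fewer than `r` elements. -/
def branchLocus {n : ℕ} (f : Fin n → MvPolynomial (Fin n) ℂ) (r : ℕ) : Set (Fin n → ℂ) :=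
  {u | (polyMap f ⁻¹' {u}).Finite ∧ (polyMap f ⁻¹' {u}).ncard < r}

end

open MvPolynomial

theorem MvPolynomial.totalDegree_pderiv_lt {σ R : Type*} [CommSemiring R] {p : MvPolynomial σ R}
    {i : σ} (h : pderiv i p ≠ 0) : (pderiv i p).totalDegree < p.totalDegree := by
  have key : ∀ m ∈ (pderiv i p).support, (m.sum fun _ e => e) < p.totalDegree := by
    intro m hm
    rw [mem_support_iff, coeff_pderiv] at hm
    have hle := le_totalDegree (mem_support_iff.2 (left_ne_zero_of_mul hm))
    rw [Finsupp.sum_add_index' (fun _ => rfl) (fun _ _ _ => rfl), Finsupp.sum_single_index rfl]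
      at hle
    omega
  obtain ⟨m, hm⟩ := support_nonempty.2 h
  exact (Finset.sup_lt_iff ((Nat.zero_le _).trans_lt (key m hm))).2 key

theorem MvPolynomial.exists_pderiv_ne_zero {σ R : Type*} [CommRing R] [IsDomain R] [CharZero R]
    {p : MvPolynomial σ R} (hp : ∀ r, p ≠ C r) : ∃ i, pderiv i p ≠ 0 := by
  by_contra! h
  refine hp (coeff 0 p) (totalDegree_eq_zero_iff_eq_C.1 ((totalDegree_eq_zero_iff _ p).2 ?_))
  intro m hm i
  by_contra hi
  have hc := congrArg (coeff (m - Finsupp.single i 1)) (h i)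
  have hle : Finsupp.single i 1 ≤ m := by
    simpa [Finsupp.single_le_iff] using Nat.one_le_iff_ne_zero.2 hi
  rw [coeff_pderiv, tsub_add_cancel_of_le hle, coeff_zero] at hc
  rcases mul_eq_zero.1 hc with hc | hc
  · exact mem_support_iff.1 hm hc
  · exact Nat.cast_add_one_ne_zero _ hc

theorem Derivation.map_mvPolynomial_aeval {R S M σ : Type*} [CommRing R] [CommRing S] [Algebra R S]
    [AddCommGroup M] [Module R M] [Module S M] [Fintype σ]
    (D : Derivation R S M) (f : σ → S) (p : MvPolynomial σ R) :
    D (MvPolynomial.aeval f p) = ∑ i, MvPolynomial.aeval f (pderiv i p) • D (f i) := by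
  classical
  induction p using MvPolynomial.induction_on with
  | C r => simp
  | add p q hp hq => simp [hp, hq, add_smul, Finset.sum_add_distrib]
  | mul_X p i hp =>
    simp only [map_mul, aeval_X, Derivation.leibniz, hp, pderiv_X, smul_eq_mul, map_add,
      add_smul, Finset.sum_add_distrib, Finset.smul_sum, mul_smul]
    congr 1
    rw [Finset.sum_eq_single i]
    · simp
    · intro j _ hj
      simp [hj.symm]
    · simp

theorem Derivation.eq_zero_of_isIntegral_quotient {A B : Type*} [CommRing A] [CommRing B]
    [Algebra A B] [Algebra.IsIntegral A B] (I : Ideal B) [CharZero (B ⧸ I)]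
    [IsDomain (B ⧸ I)]
    (D : Derivation A B (B ⧸ I)) (hD : ∀ x ∈ I, D x = 0) : D = 0 := by
  classical
  ext b
  let φ : A →+* B ⧸ I := algebraMap A (B ⧸ I)
  have hex : ∃ d, ∃ p : Polynomial A, p.map φ ≠ 0 ∧ Polynomial.aeval b p ∈ I ∧
      (p.map φ).natDegree = d := by
    obtain ⟨p, hp, hpb⟩ := Algebra.IsIntegral.isIntegral (R := A) b
    refine ⟨_, p, (hp.map φ).ne_zero, ?_, rfl⟩
    rw [Polynomial.aeval_def, hpb]
    exact I.zero_mem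
  obtain ⟨p, hp0, hpb, hpd⟩ := Nat.find_spec hex
  have hcomp : ∀ q : Polynomial A,
      (Ideal.Quotient.mk I (Polynomial.aeval b q)) =
        (q.map φ).eval (Ideal.Quotient.mk I b) := by
    intro q
    rw [Polynomial.aeval_def, Polynomial.hom_eval₂, Polynomial.eval_map]
    rfl
  have h1 := D.map_aeval p b
  rw [hD _ hpb] at h1
  have h2 : Ideal.Quotient.mk I (Polynomial.aeval b (Polynomial.derivative p)) ≠ 0 := by
    intro h
    have hdeg : (p.map φ).natDegree ≠ 0 := by
      intro h0
      have h3 := hcomp p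
      rw [Ideal.Quotient.eq_zero_iff_mem.2 hpb, Polynomial.eq_C_of_natDegree_eq_zero h0,
        Polynomial.eval_C] at h3
      rw [Polynomial.eq_C_of_natDegree_eq_zero h0, ← h3, Polynomial.C_0] at hp0
      exact hp0 rfl
    have hlt := Polynomial.natDegree_derivative_lt hdeg
    refine Nat.find_min hex (hpd ▸ hlt) ⟨Polynomial.derivative p, ?_,
      Ideal.Quotient.eq_zero_iff_mem.1 h, by rw [Polynomial.derivative_map]⟩
    rw [← Polynomial.derivative_map]
    intro h0
    exact hdeg (Polynomial.derivative_eq_zero.1 h0)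
  rw [Algebra.smul_def] at h1
  exact (mul_eq_zero.1 h1.symm).resolve_left h2

/-- Finite extensions generated by as many elements as variables have independent generators. -/
theorem algebraicIndependent_of_finite_adjoin {K : Type*} [Field K] {n : ℕ}
    (f : Fin n → MvPolynomial (Fin n) K)
    [Module.Finite (Algebra.adjoin K (Set.range f)) (MvPolynomial (Fin n) K)] :
    AlgebraicIndependent K f := by
  refine (Algebra.IsAlgebraic.isTranscendenceBasis_of_lift_le_trdeg_of_finite K f ?_).1
  rw [MvPolynomial.trdeg_of_isDomain]
  simp

theorem exists_irreducible_comap_eq_span {A B : Type*} [CommRing A] [CommRing B] [IsDomain A]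
    [IsDomain B] [UniqueFactorizationMonoid A] [Algebra A B] [FaithfulSMul A B]
    [Algebra.IsIntegral A B] [UniqueFactorizationMonoid B] {Q : B} (hQ : Prime Q) :
    ∃ P : A, Irreducible P ∧ (Ideal.span {Q}).comap (algebraMap A B) = Ideal.span {P} := by
  have hprime : (Ideal.span {Q}).IsPrime := (Ideal.span_singleton_prime hQ.ne_zero).2 hQ
  have hne : (Ideal.span {Q}).comap (algebraMap A B) ≠ ⊥ :=
    Ideal.comap_ne_bot_of_integral_mem hQ.ne_zero (Ideal.mem_span_singleton_self Q)
      (Algebra.IsIntegral.isIntegral Q)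
  obtain ⟨P, hPmem, hP⟩ := Ideal.IsPrime.exists_mem_prime_of_ne_bot
    (Ideal.IsPrime.comap (algebraMap A B)) hne
  refine ⟨P, hP.irreducible, ?_⟩
  have hPprime : (Ideal.span {P}).IsPrime := (Ideal.span_singleton_prime hP.ne_zero).2 hP
  have hle : Ideal.span {P} ≤ (Ideal.span {Q}).under A :=
    (Ideal.span_singleton_le_iff_mem _).2 hPmem
  by_contra hcon
  obtain ⟨N, hNle, hN, hover⟩ := Algebra.HasGoingDown.exists_ideal_le_liesOver_of_lt
    (p := Ideal.span {P}) (Ideal.span {Q}) (lt_of_le_of_ne hle (Ne.symm hcon))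
  have hNbot : N ≠ ⊥ := by
    rintro rfl
    have h := hover.over
    have hPm : algebraMap A B P = 0 := by
      have : P ∈ (⊥ : Ideal B).under A := h ▸ Ideal.mem_span_singleton_self P
      simpa [Ideal.mem_comap] using this
    exact hP.ne_zero ((FaithfulSMul.algebraMap_eq_zero_iff A B).1 hPm)
  have hNQ : N = Ideal.span {Q} := by
    obtain ⟨q, hqN, hq⟩ := hN.exists_mem_prime_of_ne_bot hNbot
    refine le_antisymm hNle ((Ideal.span_singleton_le_iff_mem _).2 ?_)
    have hassoc := hQ.associated_of_dvd hq (Ideal.mem_span_singleton.1 (hNle hqN))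
    exact N.mem_of_dvd hassoc.symm.dvd hqN
  exact hcon (hNQ ▸ hover.over.symm)

section RamifiedPrimes

variable {n : ℕ} {f : Fin n → MvPolynomial (Fin n) ℂ} {Q : MvPolynomial (Fin n) ℂ} {e : ℕ}

theorem exists_aeval_eq_of_mem_adjoin_range {σ R S : Type*} [CommRing R] [CommRing S] [Algebra R S]
    {f : σ → S} {x : S} (hx : x ∈ Algebra.adjoin R (Set.range f)) :
    ∃ p : MvPolynomial σ R, aeval f p = x := by
  rwa [Algebra.adjoin_range_eq_range_aeval] at hx

theorem aeval_mem_adjoin_range {σ R S : Type*} [CommRing R] [CommRing S] [Algebra R S]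
    (f : σ → S) (p : MvPolynomial σ R) : aeval f p ∈ Algebra.adjoin R (Set.range f) := by
  rw [Algebra.adjoin_range_eq_range_aeval]
  exact ⟨p, rfl⟩

theorem det_map_mk_eq_zero_iff_dvd_Jac (f : Fin n → MvPolynomial (Fin n) ℂ)
    (Q : MvPolynomial (Fin n) ℂ) :
    ((Matrix.of fun i j : Fin n => pderiv j (f i)).map
      (Ideal.Quotient.mk (Ideal.span {Q}))).det = 0 ↔ Q ∣ Jac f := by
  rw [← Ideal.mem_span_singleton, ← Ideal.Quotient.eq_zero_iff_mem, Jac, RingHom.map_det]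
  rfl

theorem dvd_Jac_of_one_lt_ramIdx (hf : AlgebraicIndependent ℂ f) (hQ : Irreducible Q)
    (h : RamIdx (Algebra.adjoin ℂ (Set.range f)) Q e) (he : 1 < e) : Q ∣ Jac f := by
  obtain ⟨P, hP, hcomap, hdvd, -⟩ := h
  obtain ⟨p, hp⟩ := exists_aeval_eq_of_mem_adjoin_range P.2
  have hprime : (Ideal.span {Q}).IsPrime :=
    (Ideal.span_singleton_prime hQ.ne_zero).2 hQ.prime
  have hpC : ∀ r, p ≠ C r := by
    rintro r rfl
    have hPr : P = algebraMap ℂ _ r := Subtype.ext (by rw [← hp, aeval_C]; rfl)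
    rcases eq_or_ne r 0 with rfl | hr
    · exact hP.ne_zero (by rw [hPr, map_zero])
    · exact hP.not_isUnit (hPr ▸ hr.isUnit.map _)
  obtain ⟨i, hi⟩ := exists_pderiv_ne_zero hpC
  rw [← det_map_mk_eq_zero_iff_dvd_Jac]
  by_contra hdet
  have hv := Matrix.eq_zero_of_vecMul_eq_zero hdet
    (v := fun i => Ideal.Quotient.mk (Ideal.span {Q}) (aeval f (pderiv i p))) (by
      ext j
      have hdP : Q ∣ pderiv j (aeval f p) := by
        obtain ⟨u, hu⟩ := (pow_dvd_pow Q he).trans hdvd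
        rw [hp, hu, pderiv_mul, pderiv_pow]
        refine dvd_add (Dvd.dvd.mul_right ?_ _) (Dvd.dvd.mul_right (dvd_pow_self Q (by simp)) _)
        exact Dvd.dvd.mul_right (Dvd.dvd.mul_left (dvd_pow_self Q (by simp)) _) _
      rw [Derivation.map_mvPolynomial_aeval, ← Ideal.mem_span_singleton,
        ← Ideal.Quotient.eq_zero_iff_mem, map_sum] at hdP
      simpa [Matrix.vecMul, dotProduct] using hdP)
  have hmem : (⟨aeval f (pderiv i p), aeval_mem_adjoin_range f _⟩ :
      Algebra.adjoin ℂ (Set.range f)) ∈ Ideal.span {P} := by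
    rw [← hcomap, Ideal.mem_comap]
    exact Ideal.Quotient.eq_zero_iff_mem.1 (congrFun hv i)
  obtain ⟨c, hc⟩ := Ideal.mem_span_singleton.1 hmem
  obtain ⟨q, hq⟩ := exists_aeval_eq_of_mem_adjoin_range c.2
  have hpq : pderiv i p = p * q := by
    apply hf
    change aeval f (pderiv i p) = aeval f (p * q)
    rw [map_mul, hp, hq]
    exact congrArg Subtype.val hc
  have hlt := totalDegree_pderiv_lt hi
  have hne : p * q ≠ 0 := hpq ▸ hi
  rw [hpq, totalDegree_mul_of_isDomain (left_ne_zero_of_mul hne) (right_ne_zero_of_mul hne)] at hlt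
  omega

theorem one_lt_ramIdx_of_dvd_Jac
    [Module.Finite (Algebra.adjoin ℂ (Set.range f)) (MvPolynomial (Fin n) ℂ)]
    (hQ : Irreducible Q) (h : RamIdx (Algebra.adjoin ℂ (Set.range f)) Q e) (hJ : Q ∣ Jac f) :
    1 < e := by
  obtain ⟨P, -, hcomap, -, hndvd⟩ := h
  have hprime : (Ideal.span {Q}).IsPrime :=
    (Ideal.span_singleton_prime hQ.ne_zero).2 hQ.prime
  by_contra he
  have hPQ : Q ∣ (P : MvPolynomial (Fin n) ℂ) := by
    rw [← Ideal.mem_span_singleton]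
    exact Ideal.mem_comap.1 (hcomap ▸ Ideal.mem_span_singleton_self P)
  obtain ⟨u, hu⟩ := hPQ
  have hQu : ¬ Q ∣ u := by
    rintro ⟨w, rfl⟩
    refine hndvd ((pow_dvd_pow Q (show e + 1 ≤ 2 by omega)).trans ⟨w, ?_⟩)
    rw [hu]
    ring
  obtain ⟨v, hv0, hv⟩ := Matrix.exists_mulVec_eq_zero_iff.2
    ((det_map_mk_eq_zero_iff_dvd_Jac f Q).2 hJ)
  have hsmul : ∀ (b : MvPolynomial (Fin n) ℂ) (t : MvPolynomial (Fin n) ℂ ⧸ Ideal.span {Q}),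
      b • t = Ideal.Quotient.mk (Ideal.span {Q}) b * t := fun b t => by
    obtain ⟨t, rfl⟩ := Ideal.Quotient.mk_surjective t
    rfl
  let D : Derivation ℂ (MvPolynomial (Fin n) ℂ) (MvPolynomial (Fin n) ℂ ⧸ Ideal.span {Q}) :=
    mkDerivation ℂ v
  have hDf : ∀ i, D (f i) = 0 := by
    intro i
    have h1 := D.map_mvPolynomial_aeval X (f i)
    rw [aeval_X_left_apply] at h1
    rw [h1]
    simpa [D, Matrix.mulVec, dotProduct, hsmul] using congrFun hv i
  have hDA : ∀ a : Algebra.adjoin ℂ (Set.range f), D a = 0 := by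
    intro a
    obtain ⟨p, hp⟩ := exists_aeval_eq_of_mem_adjoin_range a.2
    rw [← hp, D.map_mvPolynomial_aeval]
    simp [hDf]
  have hDQ : D Q = 0 := by
    have h1 := hDA P
    rw [hu, D.leibniz, hsmul, hsmul,
      Ideal.Quotient.eq_zero_iff_mem.2 (Ideal.mem_span_singleton_self Q), zero_mul, zero_add] at h1
    refine (mul_eq_zero.1 h1).resolve_left fun h2 => hQu ?_
    rwa [← Ideal.mem_span_singleton, ← Ideal.Quotient.eq_zero_iff_mem]
  let D' : Derivation (Algebra.adjoin ℂ (Set.range f)) (MvPolynomial (Fin n) ℂ)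
      (MvPolynomial (Fin n) ℂ ⧸ Ideal.span {Q}) :=
    Derivation.mk'
      { toFun := D
        map_add' := D.map_add
        map_smul' := fun a b => by
          rw [Algebra.smul_def, D.leibniz]
          change (a : MvPolynomial (Fin n) ℂ) • D b + b • D a = _
          rw [hDA, smul_zero, add_zero]
          rfl }
      D.leibniz
  have : CharZero (MvPolynomial (Fin n) ℂ ⧸ Ideal.span {Q}) :=
    charZero_of_injective_algebraMap
      (algebraMap ℂ (MvPolynomial (Fin n) ℂ ⧸ Ideal.span {Q})).injective
  have hD' : D' = 0 := by
    refine Derivation.eq_zero_of_isIntegral_quotient (Ideal.span {Q}) D' fun x hx => ?_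
    obtain ⟨w, rfl⟩ := Ideal.mem_span_singleton.1 hx
    change D (Q * w) = 0
    rw [D.leibniz, hDQ, smul_zero, add_zero, hsmul,
      Ideal.Quotient.eq_zero_iff_mem.2 (Ideal.mem_span_singleton_self Q), zero_mul]
  refine hv0 (funext fun j => ?_)
  have h1 : D (X j) = 0 := DFunLike.congr_fun hD' (X j)
  rwa [mkDerivation_X] at h1

theorem exists_ramIdx
    [Module.Finite (Algebra.adjoin ℂ (Set.range f)) (MvPolynomial (Fin n) ℂ)]
    (hQ : Irreducible Q) : ∃ e, RamIdx (Algebra.adjoin ℂ (Set.range f)) Q e := by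
  have hf := algebraicIndependent_of_finite_adjoin f
  have : UniqueFactorizationMonoid (Algebra.adjoin ℂ (Set.range f)) :=
    hf.aevalEquiv.toMulEquiv.uniqueFactorizationMonoid inferInstance
  obtain ⟨P, hP, hcomap⟩ :=
    exists_irreducible_comap_eq_span (A := Algebra.adjoin ℂ (Set.range f)) hQ.prime
  have hfin : FiniteMultiplicity Q (P : MvPolynomial (Fin n) ℂ) :=
    FiniteMultiplicity.of_not_isUnit hQ.not_isUnit fun h => hP.ne_zero (Subtype.ext h)
  exact ⟨multiplicity Q (P : MvPolynomial (Fin n) ℂ), P, hP, hcomap, pow_multiplicity_dvd _ _,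
    hfin.not_pow_dvd_of_multiplicity_lt (Nat.lt_succ_self _)⟩

theorem isRamified_iff_dvd_Jac
    [Module.Finite (Algebra.adjoin ℂ (Set.range f)) (MvPolynomial (Fin n) ℂ)]
    (hQ : Irreducible Q) : IsRamified (Algebra.adjoin ℂ (Set.range f)) Q ↔ Q ∣ Jac f := by
  refine ⟨fun ⟨_, e, h, he⟩ =>
    dvd_Jac_of_one_lt_ramIdx (algebraicIndependent_of_finite_adjoin f) hQ h he, fun hJ => ?_⟩
  obtain ⟨e, h⟩ := exists_ramIdx (f := f) hQ
  exact ⟨hQ, e, h, one_lt_ramIdx_of_dvd_Jac hQ h hJ⟩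

end RamifiedPrimes

section Subalgebra

variable {σ : Type} {A : Subalgebra ℂ (MvPolynomial σ ℂ)}

theorem exists_zero_eval_eq_of_comap_eq_span [Finite σ] [Module.Finite A (MvPolynomial σ ℂ)]
    {Q : MvPolynomial σ ℂ} {P : A}
    (hcomap : (Ideal.span {Q}).comap (algebraMap A (MvPolynomial σ ℂ)) = Ideal.span {P})
    {x : σ → ℂ} (hx : eval x (P : MvPolynomial σ ℂ) = 0) :
    ∃ y, eval y Q = 0 ∧ ∀ g ∈ A, eval y g = eval x g := by
  have hm : ((vanishingIdeal ℂ {x}).comap (algebraMap A (MvPolynomial σ ℂ))).IsMaximal :=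
    Ideal.isMaximal_comap_of_isIntegral_of_isMaximal _
  obtain ⟨N, hQN, hN, hNm⟩ := Ideal.exists_ideal_over_prime_of_isIntegral
    ((vanishingIdeal ℂ {x}).comap (algebraMap A (MvPolynomial σ ℂ))) (Ideal.span {Q}) (by
      rw [hcomap, Ideal.span_singleton_le_iff_mem, Ideal.mem_comap,
        mem_vanishingIdeal_singleton_iff]
      exact hx)
  have hNmax : N.IsMaximal :=
    Ideal.isMaximal_of_isIntegral_of_isMaximal_comap (R := A) N (hNm ▸ hm)
  obtain ⟨y, rfl⟩ := isMaximal_iff_eq_vanishingIdeal_singleton.1 hNmax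
  have hmem : ∀ a : A, eval x (a : MvPolynomial σ ℂ) = 0 → eval y (a : MvPolynomial σ ℂ) = 0 := by
    intro a ha
    have h1 : a ∈ (vanishingIdeal ℂ {x}).comap (algebraMap A (MvPolynomial σ ℂ)) := by
      rw [Ideal.mem_comap, mem_vanishingIdeal_singleton_iff]
      exact ha
    rw [← hNm, Ideal.mem_comap, mem_vanishingIdeal_singleton_iff] at h1
    exact h1
  refine ⟨y, (mem_vanishingIdeal_singleton_iff y Q).1 (hQN (Ideal.mem_span_singleton_self Q)),
    fun g hg => ?_⟩
  have h := hmem (⟨g, hg⟩ - algebraMap ℂ A (eval x g)) (by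
    change eval x (g - C (eval x g)) = 0
    simp)
  change eval y (g - C (eval x g)) = 0 at h
  simpa [sub_eq_zero] using h

theorem exists_irreducible_dvd_eval_eq_zero [Nonempty σ] {g : MvPolynomial σ ℂ} {x : σ → ℂ}
    (hx : eval x g = 0) : ∃ Q, Irreducible Q ∧ Q ∣ g ∧ eval x Q = 0 := by
  obtain ⟨h, hne, hdvd, hh⟩ : ∃ h : MvPolynomial σ ℂ, h ≠ 0 ∧ h ∣ g ∧ eval x h = 0 := by
    rcases eq_or_ne g 0 with rfl | hg
    · obtain ⟨i⟩ := ‹Nonempty σ›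
      refine ⟨X i - C (x i), fun h => ?_, dvd_zero _, by simp⟩
      simpa using congrArg (eval fun _ => x i + 1) h
    · exact ⟨g, hg, dvd_rfl, hx⟩
  obtain ⟨s, hs, u, rfl⟩ := WfDvdMonoid.exists_factors h hne
  have hu : eval x (u : MvPolynomial σ ℂ) ≠ 0 := (u.isUnit.map (eval x)).ne_zero
  rw [map_mul, mul_eq_zero, or_iff_left hu, map_multiset_prod, Multiset.prod_eq_zero_iff,
    Multiset.mem_map] at hh
  obtain ⟨Q, hQ, hQx⟩ := hh
  exact ⟨Q, hs Q hQ, ((Multiset.dvd_prod hQ).mul_right _).trans hdvd, hQx⟩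

theorem associated_of_comap_eq_span {Q' : MvPolynomial σ ℂ} {P P' : A}
    (hP : Irreducible P) (hP' : Irreducible P')
    (hcomap : (Ideal.span {Q'}).comap (algebraMap A (MvPolynomial σ ℂ)) = Ideal.span {P'})
    (hdvd : Q' ∣ (P : MvPolynomial σ ℂ)) : Associated P P' := by
  have hmem : P ∈ Ideal.span {P'} := by
    rw [← hcomap, Ideal.mem_comap, Ideal.mem_span_singleton]
    exact hdvd
  exact (hP'.associated_of_dvd hP (Ideal.mem_span_singleton.1 hmem)).symm

theorem multIs_congr {Q P P' : MvPolynomial σ ℂ} {e : ℕ} (h : Associated P P') :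
    MultIs Q P e ↔ MultIs Q P' e := by
  rw [MultIs, MultIs, h.dvd_iff_dvd_right, h.dvd_iff_dvd_right]

theorem ramReps_prod_mem {S : Finset (MvPolynomial σ ℂ)} {e : MvPolynomial σ ℂ → ℕ}
    (hS : RamReps A S e)
    (h : ∀ Q ∈ S, ∀ P : A, Irreducible P →
      (Ideal.span {Q}).comap (algebraMap A (MvPolynomial σ ℂ)) = Ideal.span {P} →
      ∀ Q', Irreducible Q' → Q' ∣ (P : MvPolynomial σ ℂ) → IsRamified A Q') :
    ∏ Q ∈ S, Q ^ e Q ∈ A := by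
  classical
  obtain ⟨hram, hassoc, huniq⟩ := hS
  let I : MvPolynomial σ ℂ → Ideal A :=
    fun Q => (Ideal.span {Q}).comap (algebraMap A (MvPolynomial σ ℂ))
  rw [← Finset.prod_fiberwise_of_maps_to (g := I) (t := S.image I)
    fun Q hQ => Finset.mem_image_of_mem I hQ]
  refine prod_mem fun p hp => ?_
  obtain ⟨Q₀, hQ₀, rfl⟩ := Finset.mem_image.1 hp
  obtain ⟨-, ⟨P, hP, hcomap, -⟩, -⟩ := hram Q₀ hQ₀
  have hfiber : ∀ Q ∈ S, Q ∣ (P : MvPolynomial σ ℂ) ↔ I Q = I Q₀ := by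
    intro Q hQ
    obtain ⟨-, ⟨P', hP', hcomap', -⟩, -⟩ := hram Q hQ
    constructor
    · intro hdvd
      simp only [I]
      rw [hcomap, hcomap', Ideal.span_singleton_eq_span_singleton]
      exact (associated_of_comap_eq_span hP hP' hcomap' hdvd).symm
    · intro heq
      have hmem : P ∈ I Q := by
        rw [heq]
        simp only [I]
        exact hcomap ▸ Ideal.mem_span_singleton_self P
      exact Ideal.mem_span_singleton.1 (Ideal.mem_comap.1 hmem)
  have hmult : ∀ Q ∈ S, Q ∣ (P : MvPolynomial σ ℂ) → MultIs Q (P : MvPolynomial σ ℂ) (e Q) := by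
    intro Q hQ hdvd
    obtain ⟨-, ⟨P', hP', hcomap', hmul⟩, -⟩ := hram Q hQ
    exact (multIs_congr
      ((associated_of_comap_eq_span hP hP' hcomap' hdvd).map A.val)).2 hmul
  obtain ⟨g, hg⟩ : ∏ Q ∈ S with I Q = I Q₀, Q ^ e Q ∣ (P : MvPolynomial σ ℂ) := by
    refine Finset.prod_dvd_of_isRelPrime (fun Q hQ Q' hQ' hne => ?_) fun Q hQ => ?_
    · simp only [Finset.coe_filter, Set.mem_ofPred_eq] at hQ hQ'
      refine IsRelPrime.pow ((hram Q hQ.1).1.isRelPrime_iff_not_dvd.2 fun hdvd => ?_)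
      exact hassoc Q hQ.1 Q' hQ'.1 hne ((hram Q hQ.1).1.associated_of_dvd (hram Q' hQ'.1).1 hdvd)
    · rw [Finset.mem_filter] at hQ
      exact (hmult Q hQ.1 ((hfiber Q hQ.1).2 hQ.2)).1
  have hP0 : (P : MvPolynomial σ ℂ) ≠ 0 := fun h0 => hP.ne_zero (Subtype.ext h0)
  have hgu : IsUnit g := by
    by_contra hgu
    obtain ⟨Q', hQ', hQ'g⟩ := WfDvdMonoid.exists_irreducible_factor hgu
      (right_ne_zero_of_mul (hg ▸ hP0))
    have hQ'P : Q' ∣ (P : MvPolynomial σ ℂ) := hg ▸ hQ'g.mul_left _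
    obtain ⟨Q, ⟨hQ, hQQ'⟩, -⟩ := huniq Q' (h Q₀ hQ₀ P hP hcomap Q' hQ' hQ'P)
    have hQP := hQQ'.dvd_iff_dvd_left.1 hQ'P
    refine (hmult Q hQ hQP).2 ?_
    rw [hg, pow_succ]
    exact mul_dvd_mul
      (Finset.dvd_prod_of_mem (fun Q => Q ^ e Q)
        (Finset.mem_filter.2 ⟨hQ, (hfiber Q hQ).1 hQP⟩))
      (hQQ'.dvd_iff_dvd_left.1 hQ'g)
  obtain ⟨r, hr, rfl⟩ := isUnit_iff_eq_C_of_isReduced.1 hgu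
  have heq : ∏ Q ∈ S with I Q = I Q₀, Q ^ e Q = (P : MvPolynomial σ ℂ) * C r⁻¹ := by
    rw [hg, mul_assoc, ← C_mul, mul_inv_cancel₀ hr.ne_zero, C_1, mul_one]
  rw [heq]
  exact mul_mem P.2 (A.algebraMap_mem r⁻¹)

end Subalgebra

open MvPolynomial in
theorem discriminant_mem_iff_images_disjoint {n : ℕ} (hn : 0 < n)
    (b : Fin n → ℕ) (hb : ∀ i, 0 < b i) (a : Fin n → ℕ)
    (f : Fin n → MvPolynomial (Fin n) ℂ)
    (hhom : ∀ i, IsWeightedHomogeneous b (f i) (a i))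
    (A : Subalgebra ℂ (MvPolynomial (Fin n) ℂ))
    (hA : A = Algebra.adjoin ℂ (Set.range f))
    (hfin : Module.Finite A (MvPolynomial (Fin n) ℂ))
    (S : Finset (MvPolynomial (Fin n) ℂ)) (eIdx : MvPolynomial (Fin n) ℂ → ℕ)
    (hS : RamReps A S eIdx) :
    (∏ Q ∈ S, Q ^ eIdx Q) ∈ A ↔
      (polyMap f '' {x | eval x (Jac f) = 0}) ∩
        (polyMap f '' {x | eval x (Jac f) = 0}ᶜ) = ∅ := by
  subst hA
  have : Nonempty (Fin n) := ⟨⟨0, hn⟩⟩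
  constructor
  · intro hD
    obtain ⟨g, hg⟩ := exists_aeval_eq_of_mem_adjoin_range hD
    have hzero : ∀ x, eval x (Jac f) = 0 ↔ eval (polyMap f x) g = 0 := by
      intro x
      have hev : eval (polyMap f x) g = ∏ Q ∈ S, eval x Q ^ eIdx Q := by
        simp only [← map_pow, ← map_prod, ← hg]
        exact (comp_aeval_apply f (aeval x : MvPolynomial (Fin n) ℂ →ₐ[ℂ] ℂ) g).symm
      rw [hev, Finset.prod_eq_zero_iff]
      constructor
      · intro hx
        obtain ⟨Q, hQ, hQJ, hQx⟩ := exists_irreducible_dvd_eval_eq_zero hx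
        obtain ⟨Q', ⟨hQ', hassoc⟩, -⟩ := hS.2.2 Q ((isRamified_iff_dvd_Jac hQ).2 hQJ)
        have hQ'x : eval x Q' = 0 := by
          obtain ⟨w, rfl⟩ := hassoc.dvd
          rw [map_mul, hQx, zero_mul]
        exact ⟨Q', hQ', by rw [hQ'x, zero_pow (by have := (hS.1 Q' hQ').2.2; omega)]⟩
      · rintro ⟨Q, hQ, hQx⟩
        obtain ⟨hirr, hidx, he⟩ := hS.1 Q hQ
        obtain ⟨w, hw⟩ := (isRamified_iff_dvd_Jac hirr).1 ⟨hirr, _, hidx, he⟩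
        rw [hw, map_mul, eq_zero_of_pow_eq_zero hQx, zero_mul]
    rw [Set.eq_empty_iff_forall_notMem]
    rintro u ⟨⟨x, hx, rfl⟩, y, hy, hxy⟩
    exact hy ((hzero y).2 (hxy ▸ (hzero x).1 hx))
  · intro hdisj
    refine ramReps_prod_mem hS fun Q hQ P hP hcomap Q' hQ' hdvd => ?_
    obtain ⟨hirr, hidx, he⟩ := hS.1 Q hQ
    have hQJ := (isRamified_iff_dvd_Jac hirr).1 ⟨hirr, _, hidx, he⟩
    have hprime : (Ideal.span {Q'}).IsPrime :=
      (Ideal.span_singleton_prime hQ'.ne_zero).2 hQ'.prime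
    rw [isRamified_iff_dvd_Jac hQ', ← Ideal.mem_span_singleton,
      ← IsPrime.vanishingIdeal_zeroLocus (K := ℂ) (Ideal.span {Q'})]
    intro x hx
    have hQ'x : eval x Q' = 0 := hx Q' (Ideal.mem_span_singleton_self Q')
    have hPx : eval x (P : MvPolynomial (Fin n) ℂ) = 0 := by
      obtain ⟨w, hw⟩ := hdvd
      rw [hw, map_mul, hQ'x, zero_mul]
    obtain ⟨y, hyQ, hy⟩ := exists_zero_eval_eq_of_comap_eq_span hcomap hPx
    have hyJ : eval y (Jac f) = 0 := by
      obtain ⟨w, hw⟩ := hQJ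
      rw [hw, map_mul, hyQ, zero_mul]
    by_contra hxJ
    have hmem : polyMap f y ∈ (polyMap f '' {x | eval x (Jac f) = 0}) ∩
        (polyMap f '' {x | eval x (Jac f) = 0}ᶜ) :=
      ⟨⟨y, hyJ, rfl⟩, x, hxJ, funext fun i => (hy _ (Algebra.subset_adjoin ⟨i, rfl⟩)).symm⟩
    rw [hdisj] at hmem
    exact hmem
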